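/- Let n,m ≥ 1 and 1 ≤ i ≤ n. If ρ ∈ S_{n+m−1} is 132-avoiding and P_i(ρ) = (σ,τ) with σ ∈ S_n, τ ∈ S_m, then both σ and τ are 132-avoiding. -/

import Mathlib

open Equiv

/-- The one-line value (0-indexed) of a permutation of `Fin N`, extended to all of `ℕ`
by the identity.  Position `j` (0-indexed) carries the value `pv σ j` (0-indexed). -/
def pv {N : ℕ} (σ : Equiv.Perm (Fin N)) (j : ℕ) : ℕ :=
  if h : j < N then (σ ⟨j, h⟩ : ℕ) else j

/-- The left weak (Bruhat) order on `S_N`: inclusion of inversion sets, where the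
inversion set of `σ` is `{(p,q) | p < q ∧ σ p > σ q}`. -/
def wle {N : ℕ} (σ τ : Equiv.Perm (Fin N)) : Prop :=
  ∀ p q : Fin N, p < q → σ q < σ p → τ q < τ p

instance {N : ℕ} (σ τ : Equiv.Perm (Fin N)) : Decidable (wle σ τ) :=
  inferInstanceAs (Decidable (∀ p q : Fin N, p < q → σ q < σ p → τ q < τ p))

/-- The `a`-values of the insertion construction `B_i` (0-indexed values):
`avv m s x = x` if `x < s` and `x + m - 1` otherwise. -/
def avv (m s x : ℕ) : ℕ := if x < s then x else x + m - 1

/-- The one-line values of the permutation `B_i(σ,τ) ∈ S_{n+m-1}`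
(0-indexed position `i`, with `i < n`, and 0-indexed values). -/
def BFun {n m : ℕ} (i : ℕ) (σ : Equiv.Perm (Fin n)) (τ : Equiv.Perm (Fin m)) (j : ℕ) : ℕ :=
  if j < i then avv m (pv σ i) (pv σ j)
  else if j < i + m then pv τ (j - i) + pv σ i
  else avv m (pv σ i) (pv σ (j - m + 1))

/-- `ρ ∈ S_{n+m-1}` is the permutation `B_i(σ,τ)`. -/
def IsB {n m : ℕ} (i : ℕ) (σ : Equiv.Perm (Fin n)) (τ : Equiv.Perm (Fin m))
    (ρ : Equiv.Perm (Fin (n + m - 1))) : Prop :=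
  ∀ j : ℕ, j < n + m - 1 → pv ρ j = BFun i σ τ j

/-- `u^ρ`: the minimum of the entries of the middle block `L₂(ρ)` (positions `[i, i+m-1]`). -/
noncomputable def uPar {N : ℕ} (i m : ℕ) (ρ : Equiv.Perm (Fin N)) : ℕ :=
  sInf (pv ρ '' {p | i ≤ p ∧ p < i + m})

/-- `v^ρ`: the maximum of the entries of the middle block `L₂(ρ)`. -/
noncomputable def vPar {N : ℕ} (i m : ℕ) (ρ : Equiv.Perm (Fin N)) : ℕ :=
  sSup (pv ρ '' {p | i ≤ p ∧ p < i + m})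

/-- `C_{1,m}^ρ`: the entries of the first block of `ρ` lying strictly between `u^ρ` and `v^ρ`. -/
noncomputable def Cmid1 {N : ℕ} (i m : ℕ) (ρ : Equiv.Perm (Fin N)) : Set ℕ :=
  {x ∈ pv ρ '' {p | p < i} | uPar i m ρ < x ∧ x < vPar i m ρ}

/-- `C_{3,m}^ρ`: the entries of the third block of `ρ` lying strictly between `u^ρ` and `v^ρ`. -/
noncomputable def Cmid3 {N : ℕ} (i m : ℕ) (ρ : Equiv.Perm (Fin N)) : Set ℕ :=
  {x ∈ pv ρ '' {p | i + m ≤ p ∧ p < N} | uPar i m ρ < x ∧ x < vPar i m ρ}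

/-- The sequence `(Bρ(1),…,Bρ(i-1), w, Bρ(i+m),…,Bρ(n+m-1))` of length `n`,
used to produce the first component of `P_i(ρ)` by standardization (here `w = u + n₁`). -/
def concatFun {N : ℕ} (i m w : ℕ) (β : Equiv.Perm (Fin N)) (r : ℕ) : ℕ :=
  if r < i then pv β r else if r = i then w else pv β (r + m - 1)

/-- `P_i(ρ) = (σ,τ)`: for `m = 1` this means `σ = ρ` and `τ = id`; for `m ≥ 2` it is
expressed via the intermediate permutation `Bρ` (denoted `β`), whose blocks standardize
like those of `ρ` and have the prescribed entry sets, `σ` being the standardization of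
`(β(1),…,β(i-1), u+n₁, β(i+m),…,β(n+m-1))` and `τ` the standardization of `L₂(ρ)`. -/
noncomputable def IsP {n m : ℕ} (i : ℕ) (ρ : Equiv.Perm (Fin (n + m - 1)))
    (σ : Equiv.Perm (Fin n)) (τ : Equiv.Perm (Fin m)) : Prop :=
  if m = 1 then (∀ p : ℕ, pv σ p = pv ρ p) ∧ τ = 1
  else
    ∃ β : Equiv.Perm (Fin (n + m - 1)),
      (∀ p q : ℕ, p < i → q < i → (pv β p < pv β q ↔ pv ρ p < pv ρ q)) ∧
      (∀ p q : ℕ, i ≤ p → p < i + m → i ≤ q → q < i + m →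
        (pv β p < pv β q ↔ pv ρ p < pv ρ q)) ∧
      (∀ p q : ℕ, i + m ≤ p → p < n + m - 1 → i + m ≤ q → q < n + m - 1 →
        (pv β p < pv β q ↔ pv ρ p < pv ρ q)) ∧
      pv β '' {p | p < i} =
        {x ∈ pv ρ '' {p | p < i} | x < uPar i m ρ} ∪
          Set.Ico (uPar i m ρ) (uPar i m ρ + (Cmid1 i m ρ).ncard) ∪
          {x ∈ pv ρ '' {p | p < i} | vPar i m ρ < x} ∧
      pv β '' {p | i ≤ p ∧ p < i + m} =
        Set.Icc (uPar i m ρ + (Cmid1 i m ρ).ncard) (vPar i m ρ - (Cmid3 i m ρ).ncard) ∧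
      pv β '' {p | i + m ≤ p ∧ p < n + m - 1} =
        {x ∈ pv ρ '' {p | i + m ≤ p ∧ p < n + m - 1} | x < uPar i m ρ} ∪
          Set.Ioc (vPar i m ρ - (Cmid3 i m ρ).ncard) (vPar i m ρ) ∪
          {x ∈ pv ρ '' {p | i + m ≤ p ∧ p < n + m - 1} | vPar i m ρ < x} ∧
      (∀ p q : Fin n, σ p < σ q ↔
        concatFun i m (uPar i m ρ + (Cmid1 i m ρ).ncard) β p <
          concatFun i m (uPar i m ρ + (Cmid1 i m ρ).ncard) β q) ∧
      (∀ p q : Fin m, τ p < τ q ↔ pv ρ (i + p) < pv ρ (i + q))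

/-- A permutation is `132`-avoiding if there are no positions `p < q < r` with
`σ_p < σ_r < σ_q`. -/
def Avoids132 {N : ℕ} (σ : Equiv.Perm (Fin N)) : Prop :=
  ∀ p q r : Fin N, p < q → q < r → ¬(σ p < σ r ∧ σ r < σ q)

lemma pv_lt {N : ℕ} (σ : Equiv.Perm (Fin N)) {j : ℕ} (hj : j < N) : pv σ j < N := by
  simp [pv, hj]

lemma pv_coe {N : ℕ} (σ : Equiv.Perm (Fin N)) (j : Fin N) : pv σ j = σ j := by
  simp [pv]

lemma pv_injOn {N : ℕ} (σ : Equiv.Perm (Fin N)) {p q : ℕ} (hp : p < N) (hq : q < N)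
    (h : pv σ p = pv σ q) : p = q := by
  simp only [pv, hp, hq, dif_pos] at h
  simpa using σ.injective (Fin.ext h)

lemma avoids132_iff_pv {N : ℕ} (σ : Equiv.Perm (Fin N)) :
    Avoids132 σ ↔ ∀ p q r : ℕ, p < q → q < r → r < N →
      ¬(pv σ p < pv σ r ∧ pv σ r < pv σ q) := by
  constructor
  · intro h p q r hpq hqr hr
    have hq := hqr.trans hr
    have hp := hpq.trans hq
    simpa [pv, hp, hq, hr] using h ⟨p, hp⟩ ⟨q, hq⟩ ⟨r, hr⟩ hpq hqr
  · intro h p q r hpq hqr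
    simpa [pv_coe] using h p q r hpq hqr r.2

/-- Two order-equivalent families whose value sets agree below `u` agree wherever one of them
takes a value below `u`. -/
lemma eq_of_lt_of_order_equiv {S : Set ℕ} {f g : ℕ → ℕ} {u : ℕ}
    (hord : ∀ p ∈ S, ∀ q ∈ S, (f p < f q ↔ g p < g q))
    (himg : ∀ x < u, (x ∈ f '' S ↔ x ∈ g '' S)) {p : ℕ} (hp : p ∈ S)
    (h : f p < u ∨ g p < u) : f p = g p := by
  have key : ∀ x, x < u → ∀ p ∈ S, (f p = x ↔ g p = x) := by
    intro x
    induction x using Nat.strong_induction_on with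
    | _ x ih =>
      intro hx
      have fwd : ∀ p ∈ S, g p = x → f p = x := by
        intro p hp hgp
        obtain ⟨q, hq, hfq⟩ := (himg x hx).2 ⟨p, hp, hgp⟩
        rcases lt_trichotomy (g q) x with hlt | heq | hgt
        · have := (ih _ hlt (hlt.trans hx) q hq).2 rfl
          omega
        · have h1 := hord p hp q hq
          have h2 := hord q hq p hp
          omega
        · have h1 := (hord p hp q hq).2 (by omega)
          have := (ih (f p) (by omega) (by omega) p hp).1 rfl
          omega
      intro p hp
      refine ⟨fun hfp => ?_, fwd p hp⟩
      obtain ⟨q, hq, hgq⟩ := (himg x hx).1 ⟨p, hp, hfp⟩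
      have h0 := fwd q hq hgq
      have h1 := hord p hp q hq
      have h2 := hord q hq p hp
      omega
  rcases h with h | h
  · exact ((key _ h p hp).1 rfl).symm
  · exact (key _ h p hp).2 rfl

/-- The dual of `eq_of_lt_of_order_equiv`, for families bounded by `B`. -/
lemma eq_of_gt_of_order_equiv {S : Set ℕ} {f g : ℕ → ℕ} {v B : ℕ}
    (hf : ∀ p ∈ S, f p ≤ B) (hg : ∀ p ∈ S, g p ≤ B)
    (hord : ∀ p ∈ S, ∀ q ∈ S, (f p < f q ↔ g p < g q))
    (himg : ∀ x, v < x → (x ∈ f '' S ↔ x ∈ g '' S)) {p : ℕ} (hp : p ∈ S)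
    (h : v < f p ∨ v < g p) : f p = g p := by
  have h1 := hf p hp
  have h2 := hg p hp
  have : B - f p = B - g p := by
    refine eq_of_lt_of_order_equiv (S := S) (f := fun q => B - f q) (g := fun q => B - g q)
      (u := B - v) ?_ ?_ hp (by omega)
    · intro p hp q hq
      have := hord q hq p hp
      have := hf p hp
      have := hf q hq
      have := hg p hp
      have := hg q hq
      omega
    · intro x hx
      constructor
      · rintro ⟨q, hq, rfl⟩
        have := hf q hq
        obtain ⟨r, hr, hrq⟩ := (himg (f q) (by grind)).1 ⟨q, hq, rfl⟩
        exact ⟨r, hr, by simp [hrq]⟩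
      · rintro ⟨q, hq, rfl⟩
        have := hg q hq
        obtain ⟨r, hr, hrq⟩ := (himg (g q) (by grind)).2 ⟨q, hq, rfl⟩
        exact ⟨r, hr, by simp [hrq]⟩
  omega

/-- If the values of `f` on `S` are those of `g`, with the ones between `u` and `v` replaced by
values in `M ⊆ [u, v]`, then an order-preserving relabelling fixes the values outside `[u, v]`. -/
lemma relabel_trichotomy {S M : Set ℕ} {f g : ℕ → ℕ} {u v B : ℕ} (huv : u ≤ v)
    (hM : ∀ x ∈ M, u ≤ x ∧ x ≤ v)
    (hf : ∀ p ∈ S, f p ≤ B) (hg : ∀ p ∈ S, g p ≤ B)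
    (hu : ∀ p ∈ S, g p ≠ u) (hv : ∀ p ∈ S, g p ≠ v)
    (hord : ∀ p ∈ S, ∀ q ∈ S, (f p < f q ↔ g p < g q))
    (himg : f '' S = {x ∈ g '' S | x < u} ∪ M ∪ {x ∈ g '' S | v < x})
    {p : ℕ} (hp : p ∈ S) :
    (f p < u ∧ g p = f p) ∨ (f p ∈ M ∧ u < g p ∧ g p < v) ∨ (v < f p ∧ g p = f p) := by
  have hlow : f p < u ∨ g p < u → f p = g p :=
    eq_of_lt_of_order_equiv hord (fun x hx => by
      rw [himg]
      simp only [Set.mem_union, Set.mem_sep_iff]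
      have := hM x
      grind) hp
  have htop : v < f p ∨ v < g p → f p = g p :=
    eq_of_gt_of_order_equiv hf hg hord (fun x hx => by
      rw [himg]
      simp only [Set.mem_union, Set.mem_sep_iff]
      have := hM x
      grind) hp
  have hmem : f p ∈ f '' S := ⟨p, hp, rfl⟩
  rw [himg] at hmem
  have := hu p hp
  have := hv p hp
  rcases hmem with (⟨-, h⟩ | h) | ⟨-, h⟩
  · exact Or.inl ⟨h, (hlow (Or.inl h)).symm⟩
  · have := hM _ h
    refine Or.inr (Or.inl ⟨h, ?_, ?_⟩) <;> by_contra hcon <;> omega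
  · exact Or.inr (Or.inr ⟨h, (htop (Or.inl h)).symm⟩)

lemma exists_pv_eq_uPar {N : ℕ} (i m : ℕ) (hm : 1 ≤ m) (ρ : Equiv.Perm (Fin N)) :
    ∃ a, i ≤ a ∧ a < i + m ∧ pv ρ a = uPar i m ρ := by
  have hne : (pv ρ '' {p | i ≤ p ∧ p < i + m}).Nonempty :=
    ⟨_, i, ⟨le_rfl, by omega⟩, rfl⟩
  obtain ⟨a, ⟨h1, h2⟩, h3⟩ := Nat.sInf_mem hne
  exact ⟨a, h1, h2, h3⟩

lemma exists_pv_eq_vPar {N : ℕ} (i m : ℕ) (hm : 1 ≤ m) (ρ : Equiv.Perm (Fin N)) :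
    ∃ b, i ≤ b ∧ b < i + m ∧ pv ρ b = vPar i m ρ := by
  have hne : (pv ρ '' {p | i ≤ p ∧ p < i + m}).Nonempty :=
    ⟨_, i, ⟨le_rfl, by omega⟩, rfl⟩
  have hfin : (pv ρ '' {p | i ≤ p ∧ p < i + m}).Finite := (Set.finite_Ico i (i + m)).image _
  obtain ⟨b, ⟨h1, h2⟩, h3⟩ := Nat.sSup_mem hne hfin.bddAbove
  exact ⟨b, h1, h2, h3⟩

/-- **Proposition.** If `ρ ∈ S_{n+m-1}` is `132`-avoiding and `P_i(ρ) = (σ,τ)`, then both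
`σ` and `τ` are `132`-avoiding. -/
theorem avoids132_of_P {n m : ℕ} (hn : 1 ≤ n) (hm : 1 ≤ m) (i : ℕ) (hi : i < n)
    (ρ : Equiv.Perm (Fin (n + m - 1))) (σ : Equiv.Perm (Fin n)) (τ : Equiv.Perm (Fin m))
    (hρ : Avoids132 ρ) (hP : IsP i ρ σ τ) :
    Avoids132 σ ∧ Avoids132 τ := by
  rw [avoids132_iff_pv] at hρ
  unfold IsP at hP
  split_ifs at hP with h1
  · obtain ⟨hσ, rfl⟩ := hP
    constructor
    · rw [avoids132_iff_pv]
      intro p q r hpq hqr hr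
      rw [hσ, hσ, hσ]
      exact hρ p q r hpq hqr (by omega)
    · intro p q r hpq hqr
      omega
  obtain ⟨β, ho1, -, ho3, hs1, hs2, hs3, hσ, hτ⟩ := hP
  constructor
  swap
  · intro p q r hpq hqr h
    rw [hτ, hτ] at h
    exact hρ _ _ _ (by simpa using hpq) (by simpa using hqr) (by omega) h
  obtain ⟨a, ha1, ha2, ha⟩ := exists_pv_eq_uPar i m hm ρ
  obtain ⟨b, hb1, hb2, hb⟩ := exists_pv_eq_vPar i m hm ρ
  have hmid : pv β i ∈ pv β '' {p | i ≤ p ∧ p < i + m} := ⟨i, ⟨le_rfl, by omega⟩, rfl⟩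
  rw [hs2, Set.mem_Icc] at hmid
  generalize uPar i m ρ = u at *
  generalize vPar i m ρ = v at *
  generalize (Cmid1 i m ρ).ncard = k at *
  generalize (Cmid3 i m ρ).ncard = l at *
  have hne : ∀ p c, p < n + m - 1 → p ≠ c → c < n + m - 1 → pv ρ p ≠ pv ρ c :=
    fun p c hp hpc hc h => hpc (pv_injOn ρ hp hc h)
  have t1 : ∀ p < i, (pv β p < u ∧ pv ρ p = pv β p) ∨
      (pv β p ∈ Set.Ico u (u + k) ∧ u < pv ρ p ∧ pv ρ p < v) ∨
      (v < pv β p ∧ pv ρ p = pv β p) := fun p hp =>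
    relabel_trichotomy (S := {p | p < i}) (B := n + m - 1) (by omega)
      (fun x hx => by rw [Set.mem_Ico] at hx; omega)
      (fun p (hp : p < i) => (pv_lt β (by omega)).le)
      (fun p (hp : p < i) => (pv_lt ρ (by omega)).le)
      (fun p (hp : p < i) => ha ▸ hne p a (by omega) (by omega) (by omega))
      (fun p (hp : p < i) => hb ▸ hne p b (by omega) (by omega) (by omega))
      (fun p hp q hq => ho1 p q hp hq) hs1 hp
  have t3 : ∀ p, i + m ≤ p → p < n + m - 1 → (pv β p < u ∧ pv ρ p = pv β p) ∨
      (pv β p ∈ Set.Ioc (v - l) v ∧ u < pv ρ p ∧ pv ρ p < v) ∨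
      (v < pv β p ∧ pv ρ p = pv β p) := fun p hp hp' =>
    relabel_trichotomy (S := {p | i + m ≤ p ∧ p < n + m - 1}) (B := n + m - 1) (by omega)
      (fun x hx => by rw [Set.mem_Ioc] at hx; omega)
      (fun p hp => (pv_lt β hp.2).le)
      (fun p hp => (pv_lt ρ hp.2).le)
      (fun p hp => ha ▸ hne p a hp.2 (by have := hp.1; omega) (by omega))
      (fun p hp => hb ▸ hne p b hp.2 (by have := hp.1; omega) (by omega))
      (fun p hp q hq => ho3 p q hp.1 hp.2 hq.1 hq.2) hs3 ⟨hp, hp'⟩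
  simp only [Set.mem_Ico, Set.mem_Ioc] at t1 t3
  rintro ⟨p, hp⟩ ⟨q, hq⟩ ⟨r, hr⟩ hpq hqr h
  rw [hσ, hσ] at h
  simp only [Fin.mk_lt_mk] at hpq hqr
  simp only [concatFun] at h
  rcases lt_trichotomy r i with hri | rfl | hri
  · have hpi : p < i := by omega
    have hqi : q < i := by omega
    simp only [hpi, hqi, hri, if_true] at h
    rw [ho1 p r hpi hri, ho1 r q hri hqi] at h
    exact hρ p q r hpq hqr (by omega) h
  · have hpi : p < r := by omega
    simp only [hpi, hqr, if_true, lt_irrefl, if_false] at h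
    have := t1 p hpi
    have := t1 q hqr
    exact hρ p q b hpq (by omega) (by omega) (by omega)
  have hr1 : ¬ r < i := by omega
  have hr2 : r ≠ i := by omega
  have hr3 : r + m - 1 < n + m - 1 := by omega
  have tr := t3 (r + m - 1) (by omega) hr3
  simp only [hr1, hr2, if_false] at h
  rcases lt_trichotomy q i with hqi | rfl | hqi
  · have hpi : p < i := by omega
    simp only [hpi, hqi, if_true] at h
    have := t1 p hpi
    have := t1 q hqi
    have := hρ p q b hpq (by omega) (by omega)
    have := hρ p q (r + m - 1) hpq (by omega) hr3
    omega
  · simp only [hpq, if_true, lt_irrefl, if_false] at h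
    have := t1 p hpq
    have := hρ p a (r + m - 1) (by omega) (by omega) hr3
    omega
  have hq1 : ¬ q < i := by omega
  have hq2 : q ≠ i := by omega
  simp only [hq1, hq2, if_false] at h
  have tq := t3 (q + m - 1) (by omega) (by omega)
  have hrq := ho3 (r + m - 1) (q + m - 1) (by omega) hr3 (by omega) (by omega)
  have hau := hρ a (q + m - 1) (r + m - 1) (by omega) (by omega) hr3
  rcases lt_trichotomy p i with hpi | rfl | hpi
  · simp only [hpi, if_true] at h
    have := t1 p hpi
    have := hρ p (q + m - 1) (r + m - 1) (by omega) (by omega) hr3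
    omega
  · simp only [lt_irrefl, if_true, if_false] at h
    omega
  · have hp1 : ¬ p < i := by omega
    have hp2 : p ≠ i := by omega
    simp only [hp1, hp2, if_false] at h
    have := ho3 (p + m - 1) (r + m - 1) (by omega) (by omega) (by omega) hr3
    exact hρ (p + m - 1) (q + m - 1) (r + m - 1) (by omega) (by omega) hr3 (by omega)
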